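/- Let n ∈ ℕ, set σ̄² = σ²/n and τ̄² = τ²/n, and for q ∈ (0,1) and x ∈ ℝ let μ̄_q(x) be the unique real number μ with F̄_μ(x) = 1−q, where F̄_μ is the conditional c.d.f. of X̃ given X̃+Ũ ∈ T with X̃ ~ N(μ, σ̄²) and Ũ ~ N(0, τ̄²) independent. Then for all x ∈ ℝ and all q₁, q₂ ∈ (0,1) with q₁ < q₂, one has μ̄_{q₂}(x) − μ̄_{q₁}(x) < (σ/√n)·(Φ⁻¹(q₂) − Φ⁻¹(q₁))·√(1 + σ²/τ²). -/

import Mathlib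

open MeasureTheory ProbabilityTheory Set Filter Topology

noncomputable def stdphi (x : ℝ) : ℝ := Real.exp (-(x ^ 2) / 2) / Real.sqrt (2 * Real.pi)

noncomputable def stdPhi (x : ℝ) : ℝ := ∫ t in Iic x, stdphi t

noncomputable def stdPhiInv : ℝ → ℝ := Function.invFun stdPhi

noncomputable def stdPhiE (c : EReal) (x s : ℝ) : ℝ :=
  if c = ⊤ then 1 else if c = ⊥ then 0 else stdPhi ((c.toReal - x) / s)

def truncOrdered {k : ℕ} (a b : Fin k → EReal) : Prop :=
  (∀ i, a i < b i) ∧ ∀ i j : Fin k, i < j → b i < a j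

def truncSet {k : ℕ} (a b : Fin k → EReal) : Set ℝ :=
  {x : ℝ | ∃ i, a i < (x : EReal) ∧ (x : EReal) < b i}

noncomputable def truncSum {k : ℕ} (a b : Fin k → EReal) (s x : ℝ) : ℝ :=
  ∑ i, (stdPhiE (b i) x s - stdPhiE (a i) x s)

noncomputable def condPDF {k : ℕ} (a b : Fin k → EReal) (σ τ μ x : ℝ) : ℝ :=
  (1 / σ) * stdphi ((x - μ) / σ) * truncSum a b τ x
    / truncSum a b (Real.sqrt (σ ^ 2 + τ ^ 2)) μ

noncomputable def Fmu {k : ℕ} (a b : Fin k → EReal) (σ τ μ x : ℝ) : ℝ :=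
  ∫ u in Iic x, condPDF a b σ τ μ u

/-- `G_μ(x,v) = Φ((x - (ρ²μ + (1-ρ²)v))/(σρ))` with `ρ² = τ²/(σ²+τ²)`. -/
noncomputable def Gfun (σ τ μ x v : ℝ) : ℝ :=
  stdPhi ((x - (τ ^ 2 / (σ ^ 2 + τ ^ 2) * μ + (1 - τ ^ 2 / (σ ^ 2 + τ ^ 2)) * v)) /
    (σ * Real.sqrt (τ ^ 2 / (σ ^ 2 + τ ^ 2))))

/-- `G_μ(x,v)` for an extended-real `v`, with the natural conventions at `±∞`. -/
noncomputable def GfunE (σ τ μ x : ℝ) (c : EReal) : ℝ :=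
  if c = ⊤ then 0 else if c = ⊥ then 1 else Gfun σ τ μ x c.toReal

/-- `h(v)` from Lemma `le_dmu_formula`. -/
noncomputable def hfun {k : ℕ} (a b : Fin k → EReal) (σ τ μ v : ℝ) : ℝ :=
  (1 / Real.sqrt (σ ^ 2 + τ ^ 2)) * stdphi ((v - μ) / Real.sqrt (σ ^ 2 + τ ^ 2)) /
    truncSum a b (Real.sqrt (σ ^ 2 + τ ^ 2)) μ

/-- `h(v)` for an extended-real `v`, with the convention `φ(±∞) = 0`. -/
noncomputable def hfunE {k : ℕ} (a b : Fin k → EReal) (σ τ μ : ℝ) (c : EReal) : ℝ :=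
  if c = ⊤ then 0 else if c = ⊥ then 0 else hfun a b σ τ μ c.toReal

/-- `l(x,v)` from Lemma `le_dens_dx`. -/
noncomputable def lfun {k : ℕ} (a b : Fin k → EReal) (τ x v : ℝ) : ℝ :=
  (1 / τ) * stdphi ((v - x) / τ) / truncSum a b τ x

/-- `l(x,v)` for an extended-real `v`, with the convention `φ(±∞) = 0`. -/
noncomputable def lfunE {k : ℕ} (a b : Fin k → EReal) (τ x : ℝ) (c : EReal) : ℝ :=
  if c = ⊤ then 0 else if c = ⊥ then 0 else lfun a b τ x c.toReal

/-- The function `B_μ(x)` from the proof of Proposition 1. -/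
noncomputable def Bfun {k : ℕ} (a b : Fin k → EReal) (σ τ μ x : ℝ) : ℝ :=
  Real.sqrt (τ ^ 2 / (σ ^ 2 + τ ^ 2)) / σ * stdphi (stdPhiInv (Fmu a b σ τ μ x))
    - condPDF a b σ τ μ x
    + ∑ i, (hfunE a b σ τ μ (b i) * (Fmu a b σ τ μ x - GfunE σ τ μ x (b i))
        - hfunE a b σ τ μ (a i) * (Fmu a b σ τ μ x - GfunE σ τ μ x (a i)))

lemma stdphi_eq_gaussianPDFReal : stdphi = gaussianPDFReal 0 1 := by
  ext x
  simp [stdphi, gaussianPDFReal, div_eq_mul_inv, mul_comm]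

lemma stdphi_pos (x : ℝ) : 0 < stdphi x := by
  unfold stdphi; positivity

@[fun_prop]
lemma continuous_stdphi : Continuous stdphi := by
  unfold stdphi; fun_prop

lemma integrable_stdphi : Integrable stdphi := by
  rw [stdphi_eq_gaussianPDFReal]; exact integrable_gaussianPDFReal 0 1

lemma integral_stdphi : ∫ x, stdphi x = 1 := by
  rw [stdphi_eq_gaussianPDFReal]; exact integral_gaussianPDFReal_eq_one 0 one_ne_zero

lemma stdphi_le_one (x : ℝ) : stdphi x ≤ 1 := by
  unfold stdphi
  rw [div_le_one (by positivity)]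
  have h1 : Real.exp (-(x ^ 2) / 2) ≤ 1 := Real.exp_le_one_iff.2 (by nlinarith [sq_nonneg x])
  have h2 : 1 ≤ Real.sqrt (2 * Real.pi) := Real.one_le_sqrt.2 (by nlinarith [Real.pi_gt_three])
  exact h1.trans h2

lemma stdphi_neg (x : ℝ) : stdphi (-x) = stdphi x := by simp [stdphi]

lemma stdphi_sub (x c : ℝ) : stdphi (x - c) = stdphi x * Real.exp (c * x - c ^ 2 / 2) := by
  unfold stdphi
  rw [div_mul_eq_mul_div, ← Real.exp_add]
  ring_nf

lemma hasDerivAt_stdphi (x : ℝ) : HasDerivAt stdphi (-x * stdphi x) x := by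
  have h : HasDerivAt (fun y : ℝ => -(y ^ 2) / 2) (-x) x := by
    refine ((hasDerivAt_pow 2 x).neg.div_const 2).congr_deriv ?_
    push_cast; ring
  refine (h.exp.div_const (Real.sqrt (2 * Real.pi))).congr_deriv ?_
  unfold stdphi; ring

lemma hasDerivAt_integral_Iic {f : ℝ → ℝ} (hf : Continuous f) (hi : Integrable f) (x : ℝ) :
    HasDerivAt (fun y => ∫ t in Iic y, f t) (f x) x := by
  have h : (fun y => ∫ t in Iic y, f t)
      = fun y => (∫ t in Iic (0 : ℝ), f t) + ∫ t in (0 : ℝ)..y, f t := by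
    ext y
    rw [← intervalIntegral.integral_Iic_sub_Iic hi.integrableOn hi.integrableOn]
    ring
  rw [h]
  exact (intervalIntegral.integral_hasDerivAt_right hi.intervalIntegrable
    (hf.stronglyMeasurableAtFilter _ _) hf.continuousAt).const_add _

lemma tendsto_integral_Iic_atTop {f : ℝ → ℝ} (hi : Integrable f) :
    Tendsto (fun y => ∫ t in Iic y, f t) atTop (𝓝 (∫ t, f t)) :=
  (aecover_Iic tendsto_id).integral_tendsto_of_countably_generated hi

lemma hasDerivAt_stdPhi (x : ℝ) : HasDerivAt stdPhi (stdphi x) x :=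
  hasDerivAt_integral_Iic continuous_stdphi integrable_stdphi x

@[fun_prop]
lemma continuous_stdPhi : Continuous stdPhi :=
  continuous_iff_continuousAt.2 fun x => (hasDerivAt_stdPhi x).continuousAt

lemma strictMono_stdPhi : StrictMono stdPhi :=
  strictMono_of_deriv_pos fun x => by rw [(hasDerivAt_stdPhi x).deriv]; exact stdphi_pos x

lemma tendsto_stdPhi_atBot : Tendsto stdPhi atBot (𝓝 0) :=
  tendsto_integral_Iic_zero tendsto_id

lemma tendsto_stdPhi_atTop : Tendsto stdPhi atTop (𝓝 1) := by
  rw [← integral_stdphi]; exact tendsto_integral_Iic_atTop integrable_stdphi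

lemma StrictMono.mem_Ioo_of_tendsto {F : ℝ → ℝ} {l u : ℝ} (hF : StrictMono F)
    (hbot : Tendsto F atBot (𝓝 l)) (htop : Tendsto F atTop (𝓝 u)) (x : ℝ) :
    F x ∈ Ioo l u :=
  ⟨(hF.monotone.le_of_tendsto hbot (x - 1)).trans_lt (hF (by linarith)),
    (hF (by linarith)).trans_le (hF.monotone.ge_of_tendsto htop (x + 1))⟩

lemma stdPhi_mem_Ioo (x : ℝ) : stdPhi x ∈ Ioo (0 : ℝ) 1 :=
  strictMono_stdPhi.mem_Ioo_of_tendsto tendsto_stdPhi_atBot tendsto_stdPhi_atTop x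

lemma stdPhi_stdPhiInv {q : ℝ} (hq : q ∈ Ioo (0 : ℝ) 1) : stdPhi (stdPhiInv q) = q := by
  refine Function.invFun_eq ?_
  obtain ⟨y, hy⟩ := (tendsto_stdPhi_atBot.eventually_lt_const hq.1).exists
  obtain ⟨z, hz⟩ := (tendsto_stdPhi_atTop.eventually_const_lt hq.2).exists
  exact mem_range_of_exists_le_of_exists_ge continuous_stdPhi ⟨y, hy.le⟩ ⟨z, hz.le⟩

lemma stdPhiInv_stdPhi (z : ℝ) : stdPhiInv (stdPhi z) = z :=
  Function.leftInverse_invFun strictMono_stdPhi.injective z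

lemma strictMonoOn_stdPhiInv : StrictMonoOn stdPhiInv (Ioo 0 1) := fun p hp q hq h => by
  rwa [← strictMono_stdPhi.lt_iff_lt, stdPhi_stdPhiInv hp, stdPhi_stdPhiInv hq]

lemma hasDerivAt_stdPhiInv {q : ℝ} (hq : q ∈ Ioo (0 : ℝ) 1) :
    HasDerivAt stdPhiInv (stdphi (stdPhiInv q))⁻¹ q := by
  have hmem : Ioo (0 : ℝ) 1 ∈ 𝓝 q := Ioo_mem_nhds hq.1 hq.2
  have himage : stdPhiInv '' Ioo 0 1 = univ :=
    eq_univ_of_forall fun z => ⟨stdPhi z, stdPhi_mem_Ioo z, stdPhiInv_stdPhi z⟩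
  refine (hasDerivAt_stdPhi _).of_local_left_inverse ?_ (stdphi_pos _).ne' ?_
  · exact continuousAt_of_monotoneOn_of_image_mem_nhds strictMonoOn_stdPhiInv.monotoneOn hmem
      (himage ▸ univ_mem)
  · filter_upwards [hmem] with p hp using stdPhi_stdPhiInv hp

lemma stdPhi_neg (x : ℝ) : stdPhi (-x) = 1 - stdPhi x := by
  have h := integral_add_compl (measurableSet_Iic (a := x)) integrable_stdphi
  have h2 : ∫ t in Iic (-x), stdphi t = ∫ t in Ioi x, stdphi t := by
    rw [← integral_comp_neg_Ioi]; simp [stdphi_neg]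
  rw [integral_stdphi, compl_Iic] at h
  unfold stdPhi
  linarith

lemma stdPhiInv_one_sub {q : ℝ} (hq : q ∈ Ioo (0 : ℝ) 1) :
    stdPhiInv (1 - q) = -stdPhiInv q := by
  rw [← stdPhiInv_stdPhi (-stdPhiInv q), stdPhi_neg, stdPhi_stdPhiInv hq]

/-- The strict tangent inequality for the Gaussian isoperimetric profile `φ ∘ Φ⁻¹`. -/
lemma stdphi_lt_tangent {y z : ℝ} (h : y ≠ z) :
    stdphi y < stdphi z - z * (stdPhi y - stdPhi z) := by
  have hd (w : ℝ) : HasDerivAt (fun w => stdphi w + z * stdPhi w) ((z - w) * stdphi w) w := by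
    refine ((hasDerivAt_stdphi w).add ((hasDerivAt_stdPhi w).const_mul z)).congr_deriv ?_
    ring
  have hc : Continuous fun w => stdphi w + z * stdPhi w := by fun_prop
  rcases h.lt_or_gt with h | h
  · have hm := strictMonoOn_of_deriv_pos (convex_Iic z) hc.continuousOn (fun w hw => by
      rw [(hd w).deriv]
      rw [interior_Iic] at hw
      exact mul_pos (sub_pos.2 hw) (stdphi_pos w))
    have := hm h.le self_mem_Iic h
    dsimp only at this
    linarith
  · have hm := strictAntiOn_of_deriv_neg (convex_Ici z) hc.continuousOn (fun w hw => by
      rw [(hd w).deriv]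
      rw [interior_Ici] at hw
      exact mul_neg_of_neg_of_pos (sub_neg.2 hw) (stdphi_pos w))
    have := hm self_mem_Ici h.le h
    dsimp only at this
    linarith

lemma lt_zero_of_deriv_sign_change {H H' w : ℝ → ℝ} (hH : ∀ u, HasDerivAt H (H' u) u)
    (hw : StrictMono w) (hneg : ∀ u, w u < 0 → H' u < 0) (hpos : ∀ u, 0 < w u → 0 < H' u)
    (hbot : Tendsto H atBot (𝓝 0)) (htop : Tendsto H atTop (𝓝 0)) (x : ℝ) : H x < 0 := by
  have hc : Continuous H := continuous_iff_continuousAt.2 fun u => (hH u).continuousAt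
  rcases le_or_gt (w x) 0 with hx | hx
  · have hm : StrictAntiOn H (Iic x) :=
      strictAntiOn_of_deriv_neg (convex_Iic x) hc.continuousOn fun u hu => by
        rw [interior_Iic] at hu
        rw [(hH u).deriv]
        exact hneg u ((hw hu).trans_le hx)
    refine (hm (show x - 1 ≤ x by linarith) self_mem_Iic (by linarith)).trans_le ?_
    refine ge_of_tendsto hbot ?_
    filter_upwards [eventually_le_atBot (x - 1)] with u hu
    exact hm.antitoneOn (show u ≤ x by linarith) (show x - 1 ≤ x by linarith) hu
  · have hm : StrictMonoOn H (Ici x) :=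
      strictMonoOn_of_deriv_pos (convex_Ici x) hc.continuousOn fun u hu => by
        rw [interior_Ici] at hu
        rw [(hH u).deriv]
        exact hpos u (hx.trans (hw hu))
    refine (hm self_mem_Ici (show x ≤ x + 1 by linarith) (by linarith)).trans_le ?_
    refine ge_of_tendsto htop ?_
    filter_upwards [eventually_ge_atTop (x + 1)] with u hu
    exact hm.monotoneOn (show x ≤ x + 1 by linarith) (show x ≤ u by linarith) hu

/-- Exponential tilting of a distribution whose isoperimetric profile lies below that of
`N(0, s²)` shifts the normal quantile of each level by more than it does for `N(0, s²)`. -/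
lemma cdf_tilt_lt {p₁ p₂ F₁ F₂ : ℝ → ℝ} {s θ c : ℝ} (hθ : 0 < θ) (hp : ∀ u, 0 < p₁ u)
    (hF₁ : ∀ u, HasDerivAt F₁ (p₁ u) u) (hF₂ : ∀ u, HasDerivAt F₂ (p₂ u) u)
    (hbot₁ : Tendsto F₁ atBot (𝓝 0)) (htop₁ : Tendsto F₁ atTop (𝓝 1))
    (hbot₂ : Tendsto F₂ atBot (𝓝 0)) (htop₂ : Tendsto F₂ atTop (𝓝 1))
    (hiso : ∀ u, s * p₁ u < stdphi (stdPhiInv (F₁ u)))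
    (htilt : ∀ u, p₂ u = p₁ u * Real.exp (θ * u + c)) (x : ℝ) :
    F₂ x < stdPhi (stdPhiInv (F₁ x) - θ * s) := by
  have hmono : StrictMono F₁ :=
    strictMono_of_deriv_pos fun u => by rw [(hF₁ u).deriv]; exact hp u
  have hmem := hmono.mem_Ioo_of_tendsto hbot₁ htop₁
  set Q : ℝ → ℝ := fun u => stdPhiInv (F₁ u) with hQdef
  have hQ (u : ℝ) : HasDerivAt Q ((stdphi (Q u))⁻¹ * p₁ u) u :=
    (hasDerivAt_stdPhiInv (hmem u)).comp u (hF₁ u)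
  have hQlt {u z : ℝ} (h : F₁ u < stdPhi z) : Q u < z := by
    rwa [← strictMono_stdPhi.lt_iff_lt, stdPhi_stdPhiInv (hmem u)]
  have hQgt {u z : ℝ} (h : stdPhi z < F₁ u) : z < Q u := by
    rwa [← strictMono_stdPhi.lt_iff_lt, stdPhi_stdPhiInv (hmem u)]
  have hQbot : Tendsto Q atBot atBot := tendsto_atBot.2 fun z => by
    filter_upwards [hbot₁.eventually_lt_const (stdPhi_mem_Ioo z).1] with u hu using (hQlt hu).le
  have hQtop : Tendsto Q atTop atTop := tendsto_atTop.2 fun z => by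
    filter_upwards [htop₁.eventually_const_lt (stdPhi_mem_Ioo z).2] with u hu using (hQgt hu).le
  set w : ℝ → ℝ := fun u => θ * u - θ * s * Q u + (c + (θ * s) ^ 2 / 2) with hwdef
  have hw (u : ℝ) : HasDerivAt w (θ - θ * s * ((stdphi (Q u))⁻¹ * p₁ u)) u := by
    refine ((((hasDerivAt_id u).const_mul θ).sub ((hQ u).const_mul (θ * s))).add_const
      (c + (θ * s) ^ 2 / 2)).congr_deriv ?_
    rw [mul_one]
  have hwmono : StrictMono w := strictMono_of_deriv_pos fun u => by
    rw [(hw u).deriv]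
    have h := (div_lt_one (stdphi_pos (Q u))).2 (hiso u)
    have : θ * (s * p₁ u / stdphi (Q u)) < θ * 1 := by gcongr
    rw [div_eq_mul_inv] at this
    linarith
  have hH (u : ℝ) : HasDerivAt (fun u => F₂ u - stdPhi (Q u - θ * s))
      (p₁ u * Real.exp (θ * s * Q u - (θ * s) ^ 2 / 2) * (Real.exp (w u) - 1)) u := by
    refine ((hF₂ u).sub ((hasDerivAt_stdPhi _).comp u
      ((hQ u).sub_const (θ * s)))).congr_deriv ?_
    have h1 : Real.exp (θ * s * Q u - (θ * s) ^ 2 / 2) * Real.exp (w u)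
        = Real.exp (θ * u + c) := by
      rw [← Real.exp_add]; congr 1; simp only [hwdef]; ring
    have h2 := (stdphi_pos (Q u)).ne'
    rw [htilt, stdphi_sub, ← h1]
    field_simp
  have hpos (u : ℝ) : 0 < p₁ u * Real.exp (θ * s * Q u - (θ * s) ^ 2 / 2) :=
    mul_pos (hp u) (Real.exp_pos _)
  have hlim {l : Filter ℝ} {L : ℝ} (h : Tendsto F₂ l (𝓝 L))
      (h' : Tendsto (fun u => stdPhi (Q u - θ * s)) l (𝓝 L)) :
      Tendsto (fun u => F₂ u - stdPhi (Q u - θ * s)) l (𝓝 0) := by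
    simpa using h.sub h'
  exact sub_neg.1 (lt_zero_of_deriv_sign_change hH hwmono
    (fun u hu => mul_neg_of_pos_of_neg (hpos u) (by simpa using hu))
    (fun u hu => mul_pos (hpos u) (by simpa using hu))
    (hlim hbot₂ (tendsto_stdPhi_atBot.comp (tendsto_atBot_add_const_right _ (-(θ * s)) hQbot)))
    (hlim htop₂ (tendsto_stdPhi_atTop.comp (tendsto_atTop_add_const_right _ (-(θ * s)) hQtop))) x)

/-- The density of `N(m, s²)`. -/
noncomputable def gaussDensity (m s x : ℝ) : ℝ := (1 / s) * stdphi ((x - m) / s)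

lemma gaussDensity_pos {s : ℝ} (hs : 0 < s) (m x : ℝ) : 0 < gaussDensity m s x :=
  mul_pos (one_div_pos.2 hs) (stdphi_pos _)

@[fun_prop]
lemma continuous_gaussDensity {X : Type*} [TopologicalSpace X] {m x : X → ℝ} (s : ℝ)
    (hm : Continuous m) (hx : Continuous x) : Continuous fun t => gaussDensity (m t) s (x t) := by
  unfold gaussDensity
  exact continuous_const.mul (continuous_stdphi.comp ((hx.sub hm).div_const s))

lemma integrable_gaussDensity {s : ℝ} (hs : 0 < s) (m : ℝ) : Integrable (gaussDensity m s) :=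
  ((integrable_stdphi.comp_div hs.ne').comp_sub_right m).const_mul _

lemma integral_gaussDensity {s : ℝ} (hs : 0 < s) (m : ℝ) : ∫ x, gaussDensity m s x = 1 := by
  unfold gaussDensity
  rw [integral_const_mul, integral_sub_right_eq_self (fun x => stdphi (x / s)),
    Measure.integral_comp_div, integral_stdphi, abs_of_pos hs, smul_eq_mul]
  field_simp

lemma setIntegral_Iic_gaussDensity {s : ℝ} (hs : 0 < s) (m r : ℝ) :
    ∫ x in Iic r, gaussDensity m s x = stdPhi ((r - m) / s) := by
  have h : (Iic r).indicator (gaussDensity m s)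
      = fun x => (1 / s) * (Iic ((r - m) / s)).indicator stdphi ((x - m) / s) := by
    ext x
    by_cases hx : x ≤ r
    · rw [indicator_of_mem (mem_Iic.2 hx), indicator_of_mem (mem_Iic.2 (by gcongr)), gaussDensity]
    · rw [indicator_of_notMem (by simpa using hx), indicator_of_notMem, mul_zero]
      rw [mem_Iic, div_le_div_iff_of_pos_right hs]
      linarith
  rw [← integral_indicator measurableSet_Iic, h, integral_const_mul,
    integral_sub_right_eq_self (fun x => (Iic ((r - m) / s)).indicator stdphi (x / s)),
    Measure.integral_comp_div, integral_indicator measurableSet_Iic, abs_of_pos hs, smul_eq_mul,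
    stdPhi]
  field_simp

/-- The joint density of `(X, X + U)` factors through the marginal of `X + U`. -/
lemma gaussDensity_mul_gaussDensity {σ τ : ℝ} (hσ : 0 < σ) (hτ : 0 < τ) (μ u v : ℝ) :
    gaussDensity μ σ u * gaussDensity u τ v
      = gaussDensity μ √(σ ^ 2 + τ ^ 2) v
        * gaussDensity ((τ ^ 2 * μ + σ ^ 2 * v) / (σ ^ 2 + τ ^ 2)) (σ * τ / √(σ ^ 2 + τ ^ 2)) u := by
  have hS : 0 < √(σ ^ 2 + τ ^ 2) := by positivity
  have hS2 : √(σ ^ 2 + τ ^ 2) ^ 2 = σ ^ 2 + τ ^ 2 := Real.sq_sqrt (by positivity)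
  have hne : σ ^ 2 + τ ^ 2 ≠ 0 := by positivity
  set S := √(σ ^ 2 + τ ^ 2)
  unfold gaussDensity stdphi
  have hexp : -((u - μ) / σ) ^ 2 / 2 + -((v - u) / τ) ^ 2 / 2
      = -((v - μ) / S) ^ 2 / 2
        + -((u - (τ ^ 2 * μ + σ ^ 2 * v) / (σ ^ 2 + τ ^ 2)) / (σ * τ / S)) ^ 2 / 2 := by
    simp only [div_pow, mul_pow, hS2]
    field_simp
    ring
  have hmul : Real.exp (-((u - μ) / σ) ^ 2 / 2) * Real.exp (-((v - u) / τ) ^ 2 / 2)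
      = Real.exp (-((v - μ) / S) ^ 2 / 2) * Real.exp
        (-((u - (τ ^ 2 * μ + σ ^ 2 * v) / (σ ^ 2 + τ ^ 2)) / (σ * τ / S)) ^ 2 / 2) := by
    rw [← Real.exp_add, ← Real.exp_add, hexp]
  generalize Real.exp (-((u - μ) / σ) ^ 2 / 2) = e₁ at *
  generalize Real.exp (-((v - u) / τ) ^ 2 / 2) = e₂ at *
  generalize Real.exp (-((v - μ) / S) ^ 2 / 2) = e₃ at *
  generalize Real.exp (-((u - (τ ^ 2 * μ + σ ^ 2 * v) / (σ ^ 2 + τ ^ 2)) / (σ * τ / S)) ^ 2 / 2)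
    = e₄ at *
  have : 0 < √(2 * Real.pi) := by positivity
  field_simp
  linear_combination hmul

/-- The sum of the Lebesgue measures on the intervals `(aᵢ, bᵢ]`. -/
noncomputable def truncMeasure {k : ℕ} (a b : Fin k → EReal) : Measure ℝ :=
  Measure.sum fun i => volume.restrict {v : ℝ | a i < v ∧ (v : EReal) ≤ b i}

section Truncation

variable {k : ℕ} {a b : Fin k → EReal}

instance : SFinite (truncMeasure a b) := by unfold truncMeasure; infer_instance

lemma integrable_truncMeasure {f : ℝ → ℝ} (hf : Integrable f) :
    Integrable f (truncMeasure a b) := by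
  rw [truncMeasure, Measure.sum_fintype]
  exact integrable_finsetSum_measure.2 fun i _ => hf.restrict

lemma measurableSet_coe_le (c : EReal) : MeasurableSet {v : ℝ | (v : EReal) ≤ c} :=
  measurableSet_le measurable_coe_real_ereal measurable_const

lemma stdPhiE_eq_setIntegral {s : ℝ} (hs : 0 < s) (c : EReal) (x : ℝ) :
    stdPhiE c x s = ∫ v in {v : ℝ | (v : EReal) ≤ c}, gaussDensity x s v := by
  unfold stdPhiE
  induction c with
  | bot => simp
  | top => simp [integral_gaussDensity hs]
  | coe r =>
    simpa [Iic] using (setIntegral_Iic_gaussDensity hs x r).symm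

lemma truncSum_eq_integral (hab : ∀ i, a i < b i) {s : ℝ} (hs : 0 < s) (x : ℝ) :
    truncSum a b s x = ∫ v, gaussDensity x s v ∂truncMeasure a b := by
  have hi := integrable_gaussDensity hs x
  rw [truncMeasure, Measure.sum_fintype, integral_finsetSum_measure fun i _ => hi.restrict]
  refine Finset.sum_congr rfl fun i _ => ?_
  have hset : {v : ℝ | a i < v ∧ (v : EReal) ≤ b i}
      = {v : ℝ | (v : EReal) ≤ b i} \ {v : ℝ | (v : EReal) ≤ a i} := by
    ext v; simp [and_comm]
  have hsub : {v : ℝ | (v : EReal) ≤ a i} ⊆ {v : ℝ | (v : EReal) ≤ b i} :=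
    fun v (hv : (v : EReal) ≤ a i) => hv.trans (hab i).le
  rw [hset, setIntegral_sdiff (measurableSet_coe_le _) hi.integrableOn hsub,
    stdPhiE_eq_setIntegral hs, stdPhiE_eq_setIntegral hs]

@[fun_prop]
lemma continuous_truncSum (s : ℝ) : Continuous (truncSum a b s) := by
  unfold truncSum stdPhiE
  refine continuous_finsetSum _ fun i _ => ?_
  split_ifs <;> fun_prop

lemma truncMeasure_singleton (x : ℝ) : truncMeasure a b {x} = 0 := by
  simp [truncMeasure]

lemma integral_truncMeasure_pos [NeZero k] (hab : ∀ i, a i < b i) {f : ℝ → ℝ} {v₀ : ℝ}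
    (hf : Integrable f (truncMeasure a b)) (hnonneg : 0 ≤ f) (hpos : ∀ v ≠ v₀, 0 < f v) :
    0 < ∫ v, f v ∂truncMeasure a b := by
  rw [integral_pos_iff_support_of_nonneg hnonneg hf]
  have hsupp : {v₀}ᶜ ⊆ Function.support f := fun v hv => (hpos v hv).ne'
  refine lt_of_lt_of_le ?_ (measure_mono hsupp)
  rw [measure_compl₀ (measurableSet_singleton _).nullMeasurableSet
    (by simp [truncMeasure_singleton]), truncMeasure_singleton, tsub_zero, truncMeasure, Measure.sum_apply _ MeasurableSet.univ]
  obtain ⟨r, hr₁, hr₂⟩ := EReal.lt_iff_exists_real_btwn.1 (hab 0)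
  obtain ⟨t, ht₁, ht₂⟩ := EReal.lt_iff_exists_real_btwn.1 hr₂
  have hrt : r < t := by exact_mod_cast ht₁
  have hsub : Ioo r t ⊆ {v : ℝ | a 0 < v ∧ (v : EReal) ≤ b 0} := fun v hv =>
    ⟨hr₁.trans (by exact_mod_cast hv.1), (lt_trans (by exact_mod_cast hv.2) ht₂).le⟩
  refine lt_of_lt_of_le ?_ (ENNReal.le_tsum 0)
  rw [Measure.restrict_apply_univ]
  refine lt_of_lt_of_le ?_ (measure_mono hsub)
  simpa using hrt

lemma truncSum_pos [NeZero k] (hab : ∀ i, a i < b i) {s : ℝ} (hs : 0 < s) (x : ℝ) :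
    0 < truncSum a b s x := by
  rw [truncSum_eq_integral hab hs]
  exact integral_truncMeasure_pos (v₀ := 0) hab
    (integrable_truncMeasure (integrable_gaussDensity hs x))
    (fun v => (gaussDensity_pos hs x v).le) fun v _ => gaussDensity_pos hs x v

lemma integrable_gaussDensity_mul_truncSum {σ : ℝ} (hσ : 0 < σ) (τ μ : ℝ) :
    Integrable fun u => gaussDensity μ σ u * truncSum a b τ u := by
  refine (integrable_gaussDensity hσ μ).mul_bdd (c := ∑ _i : Fin k, 1)
    (by fun_prop) (ae_of_all _ fun u => ?_)
  have h01 (c : EReal) : stdPhiE c u τ ∈ Icc (0 : ℝ) 1 := by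
    unfold stdPhiE
    split_ifs
    · simp
    · simp
    · exact Ioo_subset_Icc_self (stdPhi_mem_Ioo _)
  refine (norm_sum_le _ _).trans (Finset.sum_le_sum fun i _ => ?_)
  rw [Real.norm_eq_abs, abs_le]
  have h1 := h01 (a i)
  have h2 := h01 (b i)
  constructor <;> linarith [h1.1, h1.2, h2.1, h2.2]

lemma condPDF_eq_gaussDensity (σ τ μ u : ℝ) :
    condPDF a b σ τ μ u
      = gaussDensity μ σ u * truncSum a b τ u / truncSum a b √(σ ^ 2 + τ ^ 2) μ := rfl

lemma condPDF_eq_mixture (hab : ∀ i, a i < b i) {σ τ : ℝ} (hσ : 0 < σ) (hτ : 0 < τ) (μ u : ℝ) :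
    condPDF a b σ τ μ u
      = (∫ v, gaussDensity μ √(σ ^ 2 + τ ^ 2) v
          * gaussDensity ((τ ^ 2 * μ + σ ^ 2 * v) / (σ ^ 2 + τ ^ 2)) (σ * τ / √(σ ^ 2 + τ ^ 2)) u
          ∂truncMeasure a b) / truncSum a b √(σ ^ 2 + τ ^ 2) μ := by
  simp_rw [← gaussDensity_mul_gaussDensity hσ hτ]
  rw [integral_const_mul, ← truncSum_eq_integral hab hτ, condPDF_eq_gaussDensity]

lemma setIntegral_condPDF (hab : ∀ i, a i < b i) {σ τ : ℝ} (hσ : 0 < σ) (hτ : 0 < τ) (μ : ℝ)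
    (A : Set ℝ) :
    ∫ u in A, condPDF a b σ τ μ u
      = (∫ v, gaussDensity μ √(σ ^ 2 + τ ^ 2) v
          * (∫ u in A, gaussDensity ((τ ^ 2 * μ + σ ^ 2 * v) / (σ ^ 2 + τ ^ 2))
              (σ * τ / √(σ ^ 2 + τ ^ 2)) u)
          ∂truncMeasure a b) / truncSum a b √(σ ^ 2 + τ ^ 2) μ := by
  have hprod : Integrable (Function.uncurry fun u v => gaussDensity μ σ u * gaussDensity u τ v)
      ((volume.restrict A).prod (truncMeasure a b)) := by
    rw [integrable_prod_iff]
    · simp only [Function.uncurry_apply_pair]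
      refine ⟨ae_of_all _ fun u =>
        (integrable_truncMeasure (integrable_gaussDensity hτ u)).const_mul _, ?_⟩
      refine (integrable_gaussDensity_mul_truncSum (a := a) (b := b) hσ τ μ).restrict.congr
        (ae_of_all _ fun u => ?_)
      have h (v : ℝ) : ‖gaussDensity μ σ u * gaussDensity u τ v‖
          = gaussDensity μ σ u * gaussDensity u τ v :=
        Real.norm_of_nonneg (mul_pos (gaussDensity_pos hσ μ u) (gaussDensity_pos hτ u v)).le
      simp only [h]
      rw [truncSum_eq_integral hab hτ, ← integral_const_mul]
    · refine Continuous.aestronglyMeasurable ?_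
      unfold Function.uncurry
      fun_prop
  simp_rw [condPDF_eq_gaussDensity, truncSum_eq_integral hab hτ, ← integral_const_mul,
    ← gaussDensity_mul_gaussDensity hσ hτ, integral_div]
  rw [integral_integral_swap hprod]

lemma continuous_condPDF (σ τ μ : ℝ) : Continuous (condPDF a b σ τ μ) := by
  have : condPDF a b σ τ μ = fun u => _ := funext (condPDF_eq_gaussDensity σ τ μ)
  rw [this]
  exact Continuous.div_const (by fun_prop) _

lemma integrable_condPDF {σ : ℝ} (hσ : 0 < σ) (τ μ : ℝ) :
    Integrable (condPDF a b σ τ μ) :=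
  (integrable_gaussDensity_mul_truncSum hσ τ μ).div_const _

lemma condPDF_pos [NeZero k] (hab : ∀ i, a i < b i) {σ τ : ℝ} (hσ : 0 < σ) (hτ : 0 < τ)
    (μ u : ℝ) : 0 < condPDF a b σ τ μ u :=
  div_pos (mul_pos (gaussDensity_pos hσ μ u) (truncSum_pos hab hτ u))
    (truncSum_pos hab (by positivity) μ)

lemma integral_condPDF [NeZero k] (hab : ∀ i, a i < b i) {σ τ : ℝ} (hσ : 0 < σ) (hτ : 0 < τ)
    (μ : ℝ) : ∫ u, condPDF a b σ τ μ u = 1 := by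
  have hS : 0 < √(σ ^ 2 + τ ^ 2) := by positivity
  have hs : 0 < σ * τ / √(σ ^ 2 + τ ^ 2) := by positivity
  rw [← setIntegral_univ, setIntegral_condPDF hab hσ hτ]
  simp_rw [setIntegral_univ, integral_gaussDensity hs, mul_one]
  rw [← truncSum_eq_integral hab hS, div_self (truncSum_pos hab hS μ).ne']

lemma Fmu_eq_mixture (hab : ∀ i, a i < b i) {σ τ : ℝ} (hσ : 0 < σ) (hτ : 0 < τ) (μ x : ℝ) :
    Fmu a b σ τ μ x
      = (∫ v, gaussDensity μ √(σ ^ 2 + τ ^ 2) v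
          * stdPhi ((x - (τ ^ 2 * μ + σ ^ 2 * v) / (σ ^ 2 + τ ^ 2)) / (σ * τ / √(σ ^ 2 + τ ^ 2)))
          ∂truncMeasure a b) / truncSum a b √(σ ^ 2 + τ ^ 2) μ := by
  have hs : 0 < σ * τ / √(σ ^ 2 + τ ^ 2) := by positivity
  rw [Fmu, setIntegral_condPDF hab hσ hτ]
  simp_rw [setIntegral_Iic_gaussDensity hs]

lemma hasDerivAt_Fmu {σ : ℝ} (hσ : 0 < σ) (τ μ x : ℝ) :
    HasDerivAt (Fmu a b σ τ μ) (condPDF a b σ τ μ x) x :=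
  hasDerivAt_integral_Iic (continuous_condPDF σ τ μ) (integrable_condPDF hσ τ μ) x

lemma tendsto_Fmu_atBot (σ τ μ : ℝ) : Tendsto (Fmu a b σ τ μ) atBot (𝓝 0) :=
  tendsto_integral_Iic_zero tendsto_id

lemma tendsto_Fmu_atTop [NeZero k] (hab : ∀ i, a i < b i) {σ τ : ℝ} (hσ : 0 < σ) (hτ : 0 < τ)
    (μ : ℝ) : Tendsto (Fmu a b σ τ μ) atTop (𝓝 1) := by
  rw [← integral_condPDF hab hσ hτ μ]
  exact tendsto_integral_Iic_atTop (integrable_condPDF hσ τ μ)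

lemma Fmu_mem_Ioo [NeZero k] (hab : ∀ i, a i < b i) {σ τ : ℝ} (hσ : 0 < σ) (hτ : 0 < τ)
    (μ x : ℝ) : Fmu a b σ τ μ x ∈ Ioo (0 : ℝ) 1 :=
  (strictMono_of_deriv_pos fun u => by
    rw [(hasDerivAt_Fmu hσ τ μ u).deriv]
    exact condPDF_pos hab hσ hτ μ u).mem_Ioo_of_tendsto
      (tendsto_Fmu_atBot σ τ μ) (tendsto_Fmu_atTop hab hσ hτ μ) x

/-- The isoperimetric profile of the conditional law lies below that of `N(0, s²)` with
`s = στ / √(σ² + τ²)`, because the law is a mixture of translates of `N(0, s²)`. -/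
lemma condPDF_isoperimetric [NeZero k] (hab : ∀ i, a i < b i) {σ τ : ℝ} (hσ : 0 < σ)
    (hτ : 0 < τ) (μ x : ℝ) :
    σ * τ / √(σ ^ 2 + τ ^ 2) * condPDF a b σ τ μ x
      < stdphi (stdPhiInv (Fmu a b σ τ μ x)) := by
  have hS : 0 < √(σ ^ 2 + τ ^ 2) := by positivity
  have hs : 0 < σ * τ / √(σ ^ 2 + τ ^ 2) := by positivity
  have hD := truncSum_pos hab hS μ
  have hz := stdPhi_stdPhiInv (Fmu_mem_Ioo hab hσ hτ μ x)
  have hF := Fmu_eq_mixture hab hσ hτ μ x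
  have hp := condPDF_eq_mixture hab hσ hτ μ x
  have hD' := truncSum_eq_integral hab hS μ
  set z := stdPhiInv (Fmu a b σ τ μ x)
  set s := σ * τ / √(σ ^ 2 + τ ^ 2)
  set y : ℝ → ℝ := fun v => (x - (τ ^ 2 * μ + σ ^ 2 * v) / (σ ^ 2 + τ ^ 2)) / s with hy
  set g := gaussDensity μ √(σ ^ 2 + τ ^ 2)
  have hyc : Continuous y := by fun_prop
  have hg : Integrable g (truncMeasure a b) :=
    integrable_truncMeasure (integrable_gaussDensity hS μ)
  have hgΦ : Integrable (fun v => g v * stdPhi (y v)) (truncMeasure a b) :=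
    hg.mul_bdd (c := 1) (by fun_prop) (ae_of_all _ fun v => by
      rw [Real.norm_of_nonneg (stdPhi_mem_Ioo _).1.le]; exact (stdPhi_mem_Ioo _).2.le)
  have hgφ : Integrable (fun v => g v * stdphi (y v)) (truncMeasure a b) :=
    hg.mul_bdd (c := 1) (by fun_prop) (ae_of_all _ fun v => by
      rw [Real.norm_of_nonneg (stdphi_pos _).le]; exact stdphi_le_one _)
  have hsp : s * condPDF a b σ τ μ x
      = (∫ v, g v * stdphi (y v) ∂truncMeasure a b) / truncSum a b √(σ ^ 2 + τ ^ 2) μ := by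
    rw [hp, ← mul_div_assoc, ← integral_const_mul]
    have hv (v : ℝ) : s * (g v * gaussDensity
        ((τ ^ 2 * μ + σ ^ 2 * v) / (σ ^ 2 + τ ^ 2)) s x) = g v * stdphi (y v) := by
      change s * (g v * (1 / s * stdphi (y v))) = _
      field_simp
    simp_rw [hv]
  have hlin := (hg.const_mul (stdphi z + z * stdPhi z)).sub (hgΦ.const_mul z)
  have hpos : 0 < ∫ v, ((stdphi z + z * stdPhi z) * g v - z * (g v * stdPhi (y v)))
      - g v * stdphi (y v) ∂truncMeasure a b := by
    have hkey (v : ℝ) (h : y v ≠ z) :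
        0 < ((stdphi z + z * stdPhi z) * g v - z * (g v * stdPhi (y v))) - g v * stdphi (y v) := by
      have := mul_pos (gaussDensity_pos hS μ v) (sub_pos.2 (stdphi_lt_tangent h))
      linarith
    refine integral_truncMeasure_pos hab
      (v₀ := ((x - z * s) * (σ ^ 2 + τ ^ 2) - τ ^ 2 * μ) / σ ^ 2)
      (hlin.sub hgφ) (fun v => ?_) fun v hv => hkey v ?_
    · by_cases h : y v = z
      · simp only [h, Pi.zero_apply]; linarith
      · exact (hkey v h).le
    · contrapose! hv
      rw [← hv, hy]
      field_simp
      ring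
  rw [integral_sub (by exact hlin) hgφ,
    integral_sub (hg.const_mul _) (hgΦ.const_mul _), integral_const_mul, integral_const_mul,
    ← hD'] at hpos
  rw [hsp, div_lt_iff₀ hD]
  rw [eq_div_iff hD.ne'] at hF
  rw [← hF, hz] at hpos
  linarith

lemma condPDF_tilt [NeZero k] (hab : ∀ i, a i < b i) {σ τ : ℝ} (hσ : 0 < σ) (hτ : 0 < τ)
    (μ₁ μ₂ : ℝ) : ∃ c : ℝ, ∀ u, condPDF a b σ τ μ₂ u
      = condPDF a b σ τ μ₁ u * Real.exp ((μ₂ - μ₁) / σ ^ 2 * u + c) := by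
  have hS : 0 < √(σ ^ 2 + τ ^ 2) := by positivity
  have hD₁ := truncSum_pos hab hS μ₁
  have hD₂ := truncSum_pos hab hS μ₂
  set D₁ := truncSum a b √(σ ^ 2 + τ ^ 2) μ₁
  set D₂ := truncSum a b √(σ ^ 2 + τ ^ 2) μ₂
  refine ⟨(μ₁ ^ 2 - μ₂ ^ 2) / (2 * σ ^ 2) + Real.log (D₁ / D₂), fun u => ?_⟩
  have h : gaussDensity μ₂ σ u = gaussDensity μ₁ σ u
      * Real.exp ((μ₂ - μ₁) / σ ^ 2 * u + (μ₁ ^ 2 - μ₂ ^ 2) / (2 * σ ^ 2)) := by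
    have h' : (u - μ₂) / σ = (u - μ₁) / σ - (μ₂ - μ₁) / σ := by ring
    unfold gaussDensity
    rw [h', stdphi_sub, ← mul_assoc]
    congr 2
    field_simp
    ring
  rw [condPDF_eq_gaussDensity, condPDF_eq_gaussDensity, ← add_assoc, Real.exp_add,
    Real.exp_log (div_pos hD₁ hD₂), h]
  change _ / D₂ = _ / D₁ * _
  field_simp

lemma Fmu_lt_of_lt [NeZero k] (hab : ∀ i, a i < b i) {σ τ : ℝ} (hσ : 0 < σ) (hτ : 0 < τ)
    {μ₁ μ₂ : ℝ} (hμ : μ₁ < μ₂) (x : ℝ) :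
    Fmu a b σ τ μ₂ x < stdPhi (stdPhiInv (Fmu a b σ τ μ₁ x)
      - (μ₂ - μ₁) / σ ^ 2 * (σ * τ / √(σ ^ 2 + τ ^ 2))) := by
  obtain ⟨c, hc⟩ := condPDF_tilt hab hσ hτ μ₁ μ₂
  exact cdf_tilt_lt (div_pos (sub_pos.2 hμ) (by positivity)) (condPDF_pos hab hσ hτ μ₁)
    (hasDerivAt_Fmu hσ τ μ₁) (hasDerivAt_Fmu hσ τ μ₂) (tendsto_Fmu_atBot σ τ μ₁)
    (tendsto_Fmu_atTop hab hσ hτ μ₁) (tendsto_Fmu_atBot σ τ μ₂)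
    (tendsto_Fmu_atTop hab hσ hτ μ₂) (condPDF_isoperimetric hab hσ hτ μ₁) hc x

end Truncation

/-- Randomized-response interval-length bound: with `σ̄² = σ²/n` and `τ̄² = τ²/n`, the interval
length is bounded by `(σ/√n)(Φ⁻¹(q₂) - Φ⁻¹(q₁))·√(1 + σ²/τ²)`. -/
theorem stmt6 {k : ℕ} (a b : Fin (k + 1) → EReal) (hab : truncOrdered a b)
    (σ τ : ℝ) (hσ : 0 < σ) (hτ : 0 < τ) (n : ℕ) (hn : 0 < n)
    (σb τb : ℝ) (hσb : σb = σ / Real.sqrt n) (hτb : τb = τ / Real.sqrt n)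
    (μq : ℝ → ℝ → ℝ)
    (hμq : ∀ q ∈ Ioo (0 : ℝ) 1, ∀ x : ℝ, Fmu a b σb τb (μq q x) x = 1 - q)
    (x : ℝ) (q₁ q₂ : ℝ) (hq₁ : q₁ ∈ Ioo (0 : ℝ) 1) (hq₂ : q₂ ∈ Ioo (0 : ℝ) 1)
    (hq : q₁ < q₂) :
    μq q₂ x - μq q₁ x
      < σ / Real.sqrt n * (stdPhiInv q₂ - stdPhiInv q₁)
          * Real.sqrt (1 + σ ^ 2 / τ ^ 2) := by
  have hn' : 0 < √(n : ℝ) := by positivity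
  have hσb' : 0 < σb := hσb ▸ by positivity
  have hτb' : 0 < τb := hτb ▸ by positivity
  have hΦ := strictMonoOn_stdPhiInv hq₁ hq₂ hq
  have hconst : σ / √n * √(1 + σ ^ 2 / τ ^ 2) = σb * √(σb ^ 2 + τb ^ 2) / τb := by
    have h₁ : 1 + σ ^ 2 / τ ^ 2 = (σb ^ 2 + τb ^ 2) / τb ^ 2 := by
      rw [hσb, hτb]; field_simp; ring
    rw [h₁, Real.sqrt_div (by positivity), Real.sqrt_sq hτb'.le, ← hσb, mul_div_assoc]
  rw [mul_right_comm, hconst]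
  rcases le_or_gt (μq q₂ x) (μq q₁ x) with hμ | hμ
  · exact (sub_nonpos.2 hμ).trans_lt (mul_pos (by positivity) (sub_pos.2 hΦ))
  · have h := Fmu_lt_of_lt hab.1 hσb' hτb' hμ x
    have hq₂' : 1 - q₂ ∈ Ioo (0 : ℝ) 1 := ⟨by linarith [hq₂.2], by linarith [hq₂.1]⟩
    rw [hμq q₁ hq₁, hμq q₂ hq₂, ← stdPhi_stdPhiInv hq₂', strictMono_stdPhi.lt_iff_lt,
      stdPhiInv_one_sub hq₁, stdPhiInv_one_sub hq₂] at h
    have hS : 0 < √(σb ^ 2 + τb ^ 2) := by positivity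
    set S := √(σb ^ 2 + τb ^ 2)
    have h' : (μq q₂ x - μq q₁ x) / σb ^ 2 * (σb * τb / S) < stdPhiInv q₂ - stdPhiInv q₁ := by
      linarith
    have := mul_lt_mul_of_pos_left h' (show 0 < σb * S / τb by positivity)
    refine lt_of_eq_of_lt ?_ this
    field_simp
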